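/- Let n ≥ 3 and let P be the normalized (n−1)-dimensional Hausdorff (surface) probability measure on the unit sphere S^{n−1} ⊂ ℝⁿ. There exist s ∈ (0,1) and a sequence (u_j) of points of S^{n−1} such that for every unit vector w, writing C_s(w) = { v ∈ S^{n−1} : w · v ≥ s } for the spherical cap determined by w and s, one has lim_{N→∞} (1/N) · #{ j ≤ N : u_j ∈ C_s(w) } = P(C_s(w)), and yet (u_j) is not uniformly distributed on S^{n−1}: there exists a Borel set A ⊆ S^{n−1} with P(∂A) = 0 and (1/N) · #{ j ≤ N : u_j ∈ A } not converging to P(A). -/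

import Mathlib

open MeasureTheory Filter Metric
open scoped RealInnerProductSpace

open scoped Classical in
/-- Relative frequency of hits of the first `N` terms of the sequence `u` in the set `A`. -/
noncomputable def freq {α : Type*} (u : ℕ → α) (A : Set α) (N : ℕ) : ℝ :=
  ((Finset.range N).filter (fun j => u j ∈ A)).card / N

/-- The normalized `(n-1)`-dimensional Hausdorff probability measure on the unit sphere
`S^{n-1} ⊂ ℝⁿ`. -/
noncomputable def sphereMeasure (n : ℕ) :
    Measure (sphere (0 : EuclideanSpace ℝ (Fin n)) 1) :=
  (μH[(n : ℝ) - 1] (Set.univ : Set (sphere (0 : EuclideanSpace ℝ (Fin n)) 1)))⁻¹ •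
    μH[(n : ℝ) - 1]

/-- The spherical cap `C_s(w) = {v ∈ S^{n-1} : w ⬝ v ≥ s}`. -/
def cap (n : ℕ) (s : ℝ) (w : sphere (0 : EuclideanSpace ℝ (Fin n)) 1) :
    Set (sphere (0 : EuclideanSpace ℝ (Fin n)) 1) :=
  {v | s ≤ ⟪(w : EuclideanSpace ℝ (Fin n)), (v : EuclideanSpace ℝ (Fin n))⟫}


open ProbabilityTheory in
/-- Almost every i.i.d. sequence realises the prescribed frequencies of countably many sets. -/
theorem exists_seq_tendsto_freq {X ι : Type*} [MeasurableSpace X] [Countable ι] (ν : Measure X)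
    [IsProbabilityMeasure ν] (B : ι → Set X) (hB : ∀ i, MeasurableSet (B i)) :
    ∃ u : ℕ → X, ∀ i, Tendsto (freq u (B i)) atTop (nhds (ν.real (B i))) := by
  have key : ∀ i, ∀ᵐ ω ∂(Measure.infinitePi fun _ : ℕ => ν),
      Tendsto (freq ω (B i)) atTop (nhds (ν.real (B i))) := by
    intro i
    have hm : Measurable ((B i).indicator (fun _ => (1 : ℝ))) :=
      measurable_const.indicator (hB i)
    have hmp := fun j : ℕ => measurePreserving_eval_infinitePi (fun _ : ℕ => ν) j
    have hident : ∀ j : ℕ, IdentDistrib (fun ω : ℕ → X => (B i).indicator (fun _ => (1 : ℝ)) (ω j))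
        (fun ω : ℕ → X => (B i).indicator (fun _ => (1 : ℝ)) (ω 0))
        (Measure.infinitePi fun _ : ℕ => ν) (Measure.infinitePi fun _ : ℕ => ν) := by
      intro j
      have h0 : IdentDistrib (fun ω : ℕ → X => ω j) (fun ω : ℕ → X => ω 0)
          (Measure.infinitePi fun _ : ℕ => ν) (Measure.infinitePi fun _ : ℕ => ν) :=
        ⟨(measurable_pi_apply j).aemeasurable, (measurable_pi_apply 0).aemeasurable,
          (hmp j).map_eq.trans (hmp 0).map_eq.symm⟩
      exact h0.comp hm
    have hslln := strong_law_ae_real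
      (fun (j : ℕ) (ω : ℕ → X) => (B i).indicator (fun _ => (1 : ℝ)) (ω j))
      ((hmp 0).integrable_comp_of_integrable ((integrable_const (1 : ℝ)).indicator (hB i)))
      (fun j k hjk => (iIndepFun_infinitePi (P := fun _ : ℕ => ν) (fun _ => hm)).indepFun hjk)
      hident
    have hint : ∫ ω, (B i).indicator (fun _ => (1 : ℝ)) (ω 0) ∂(Measure.infinitePi fun _ : ℕ => ν)
        = ν.real (B i) := by
      rw [← integral_indicator_one (hB i)]
      have := (hmp 0).map_eq
      conv_rhs => rw [← this]
      rw [integral_map (measurable_pi_apply 0).aemeasurable]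
      · rfl
      · exact hm.aestronglyMeasurable
    rw [hint] at hslln
    filter_upwards [hslln] with ω hω
    refine hω.congr fun N => ?_
    rw [freq, Finset.card_filter]
    push_cast
    congr 1
  obtain ⟨ω, hω⟩ := (ae_all_iff.2 key).exists
  exact ⟨ω, hω⟩

theorem freq_mono {α : Type*} (u : ℕ → α) {A B : Set α} (h : A ⊆ B) (N : ℕ) :
    freq u A N ≤ freq u B N := by
  unfold freq
  gcongr

theorem freq_compl {α : Type*} (u : ℕ → α) (A : Set α) {N : ℕ} (hN : 0 < N) :
    freq u Aᶜ N = 1 - freq u A N := by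
  classical
  have hN' : (N : ℝ) ≠ 0 := by positivity
  have := Finset.card_filter_add_card_filter_not (s := Finset.range N) (fun j => u j ∈ A)
  rw [Finset.card_range] at this
  simp only [freq, Set.mem_compl_iff]
  rw [eq_sub_iff_add_eq, ← add_div, div_eq_one_iff_eq hN', add_comm]
  exact_mod_cast this

/-- An open set is approximated in measure from inside by finite unions of basic open sets. -/
theorem exists_finset_countableBasis_lt_measureReal {X : Type*} [TopologicalSpace X]
    [SecondCountableTopology X] [MeasurableSpace X] (ν : Measure X)
    [IsFiniteMeasure ν] {G : Set X} (hG : IsOpen G) {ε : ℝ} (hε : 0 < ε) :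
    ∃ F : Finset (TopologicalSpace.countableBasis X),
      (⋃ b ∈ F, (b : Set X)) ⊆ G ∧ ν.real G - ε < ν.real (⋃ b ∈ F, (b : Set X)) := by
  classical
  have hc : Countable (TopologicalSpace.countableBasis X) :=
    TopologicalSpace.countable_countableBasis X
  let g : Finset (TopologicalSpace.countableBasis X) → Finset (TopologicalSpace.countableBasis X) :=
    fun F => F.filter fun b => (b : Set X) ⊆ G
  have hg : ∀ F, (⋃ b ∈ g F, (b : Set X)) ⊆ G := fun F =>
    Set.iUnion₂_subset fun b hb => (Finset.mem_filter.1 hb).2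
  have hmono : Monotone fun F => ⋃ b ∈ g F, (b : Set X) := fun F F' h =>
    Set.biUnion_subset_biUnion_left (Finset.filter_subset_filter _ h)
  have hU : ⋃ F, ⋃ b ∈ g F, (b : Set X) = G := by
    refine Set.Subset.antisymm (Set.iUnion_subset hg) fun x hx => ?_
    obtain ⟨b, hb, hxb, hbG⟩ :=
      (TopologicalSpace.isBasis_countableBasis X).exists_subset_of_mem_open hx hG
    exact Set.mem_iUnion.2 ⟨{⟨b, hb⟩}, Set.mem_iUnion₂.2 ⟨⟨b, hb⟩, by simp [g, hbG], hxb⟩⟩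
  have ht := tendsto_measure_iUnion_atTop (μ := ν) hmono
  rw [hU] at ht
  have ht' := (ENNReal.tendsto_toReal (measure_ne_top ν G)).comp ht
  obtain ⟨F, hF⟩ :=
    (ht'.eventually (lt_mem_nhds (sub_lt_self (ν G).toReal hε))).exists
  exact ⟨g F, hg F, hF⟩

/-- Every Borel probability measure on a second countable space has a uniformly distributed
sequence. -/
theorem exists_seq_tendsto_freq_of_null_frontier {X : Type*} [TopologicalSpace X]
    [SecondCountableTopology X] [MeasurableSpace X] [OpensMeasurableSpace X] (ν : Measure X)
    [IsProbabilityMeasure ν] :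
    ∃ u : ℕ → X, ∀ A : Set X, ν (frontier A) = 0 →
      Tendsto (freq u A) atTop (nhds (ν.real A)) := by
  have hc : Countable (TopologicalSpace.countableBasis X) :=
    TopologicalSpace.countable_countableBasis X
  have hopen : ∀ F : Finset (TopologicalSpace.countableBasis X), IsOpen (⋃ b ∈ F, (b : Set X)) :=
    fun F => isOpen_biUnion fun b _ => TopologicalSpace.isOpen_of_mem_countableBasis b.2
  obtain ⟨u, hu⟩ := exists_seq_tendsto_freq ν
    (fun F : Finset (TopologicalSpace.countableBasis X) => ⋃ b ∈ F, (b : Set X))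
    (fun F => (hopen F).measurableSet)
  have lower : ∀ A : Set X, ν (frontier A) = 0 → ∀ ε > 0,
      ∀ᶠ N in atTop, ν.real A - ε < freq u A N := by
    intro A hA ε hε
    have hAi : ν.real (interior A) = ν.real A :=
      measureReal_congr (interior_ae_eq_of_null_frontier hA)
    obtain ⟨F, hFA, hF⟩ := exists_finset_countableBasis_lt_measureReal ν
      (isOpen_interior (s := A)) hε
    rw [hAi] at hF
    filter_upwards [(hu F).eventually (lt_mem_nhds hF)] with N hN
    exact hN.trans_le (freq_mono u (hFA.trans interior_subset) N)
  refine ⟨u, fun A hA => ?_⟩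
  have hAc : ν.real Aᶜ = 1 - ν.real A := by
    have hnull : NullMeasurableSet A ν := by
      exact isOpen_interior.measurableSet.nullMeasurableSet.congr
        (interior_ae_eq_of_null_frontier hA)
    rw [measureReal_compl₀ hnull]
    simp
  rw [Metric.tendsto_atTop']
  intro ε hε
  have h1 := lower A hA ε hε
  have h2 := lower Aᶜ (by rwa [frontier_compl]) ε hε
  obtain ⟨N, hN⟩ := eventually_atTop.1 (h1.and (h2.and (eventually_gt_atTop 0)))
  refine ⟨N, fun k hk => ?_⟩
  obtain ⟨a, b, c⟩ := hN k hk.le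
  rw [freq_compl u A c, hAc] at b
  rw [Real.dist_eq, abs_lt]
  constructor <;> linarith

section Sphere

variable {n : ℕ}

/-- The isometry of the unit sphere induced by a linear isometry. -/
noncomputable def sphereIsometry (ρ : EuclideanSpace ℝ (Fin n) ≃ₗᵢ[ℝ] EuclideanSpace ℝ (Fin n)) :
    sphere (0 : EuclideanSpace ℝ (Fin n)) 1 ≃ᵢ sphere (0 : EuclideanSpace ℝ (Fin n)) 1 where
  toFun x := ⟨ρ x, by simp⟩
  invFun x := ⟨ρ.symm x, by simp⟩
  left_inv x := by simp
  right_inv x := by simp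
  isometry_toFun x y := ρ.isometry x y

@[simp] theorem coe_sphereIsometry
    (ρ : EuclideanSpace ℝ (Fin n) ≃ₗᵢ[ℝ] EuclideanSpace ℝ (Fin n))
    (x : sphere (0 : EuclideanSpace ℝ (Fin n)) 1) :
    (sphereIsometry ρ x : EuclideanSpace ℝ (Fin n)) = ρ x :=
  rfl

/-- Two vectors of equal norm are swapped by a reflection fixing every vector which has the same
inner product with both. -/
theorem exists_isometry_swap {E : Type*} [NormedAddCommGroup E] [InnerProductSpace ℝ E]
    {a b : E} (h : ‖a‖ = ‖b‖) :
    ∃ ρ : E ≃ₗᵢ[ℝ] E, ρ a = b ∧ ρ b = a ∧ ∀ c, ⟪c, a⟫ = ⟪c, b⟫ → ρ c = c := by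
  refine ⟨(ℝ ∙ (a - b))ᗮ.reflection, Submodule.reflection_sub h, ?_, fun c hc => ?_⟩
  · have := Submodule.reflection_reflection (ℝ ∙ (a - b))ᗮ a
    rwa [Submodule.reflection_sub h] at this
  · apply Submodule.reflection_mem_subspace_eq_self
    rw [Submodule.mem_orthogonal_singleton_iff_inner_left, inner_sub_right, hc, sub_self]

/-- Invariance of a measure on the sphere under all linear isometries. -/
def SphereInvariant (μ : Measure (sphere (0 : EuclideanSpace ℝ (Fin n)) 1)) : Prop :=
  ∀ ρ : EuclideanSpace ℝ (Fin n) ≃ₗᵢ[ℝ] EuclideanSpace ℝ (Fin n),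
    MeasurePreserving (sphereIsometry ρ) μ μ

theorem SphereInvariant.integral_comp {μ : Measure (sphere (0 : EuclideanSpace ℝ (Fin n)) 1)}
    (hμ : SphereInvariant μ) (ρ : EuclideanSpace ℝ (Fin n) ≃ₗᵢ[ℝ] EuclideanSpace ℝ (Fin n))
    (f : EuclideanSpace ℝ (Fin n) → ℝ) :
    ∫ x, f (ρ (x : EuclideanSpace ℝ (Fin n))) ∂μ = ∫ x, f (x : EuclideanSpace ℝ (Fin n)) ∂μ :=
  (hμ ρ).integral_comp (sphereIsometry ρ).toHomeomorph.measurableEmbedding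
    (fun x => f (x : EuclideanSpace ℝ (Fin n)))

theorem exists_sphereIsometry_apply_eq (x y : sphere (0 : EuclideanSpace ℝ (Fin n)) 1) :
    ∃ ρ, sphereIsometry ρ x = y := by
  obtain ⟨ρ, hρ, -⟩ := exists_isometry_swap
    (a := (x : EuclideanSpace ℝ (Fin n))) (b := (y : EuclideanSpace ℝ (Fin n))) (by simp)
  exact ⟨ρ, Subtype.ext hρ⟩

theorem SphereInvariant.isFiniteMeasure {μ : Measure (sphere (0 : EuclideanSpace ℝ (Fin n)) 1)}
    (hμ : SphereInvariant μ) {U : Set (sphere (0 : EuclideanSpace ℝ (Fin n)) 1)}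
    (hne : (interior U).Nonempty) (hU : μ U < ⊤) : IsFiniteMeasure μ := by
  obtain ⟨y, hy⟩ := hne
  refine ⟨isCompact_univ.measure_lt_top_of_nhdsWithin fun x _ => ?_⟩
  obtain ⟨ρ, hρ⟩ := exists_sphereIsometry_apply_eq x y
  refine ⟨sphereIsometry ρ ⁻¹' interior U, ?_, ?_⟩
  · rw [nhdsWithin_univ]
    exact (isOpen_interior.preimage (sphereIsometry ρ).continuous).mem_nhds (by simpa [hρ] using hy)
  · rw [(hμ ρ).measure_preimage isOpen_interior.measurableSet.nullMeasurableSet]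
    exact (measure_mono interior_subset).trans_lt hU

theorem SphereInvariant.isOpenPosMeasure
    {μ : Measure (sphere (0 : EuclideanSpace ℝ (Fin n)) 1)}
    (hμ : SphereInvariant μ) (h0 : μ Set.univ ≠ 0) : μ.IsOpenPosMeasure := by
  refine ⟨fun U hU hne hU0 => h0 ?_⟩
  obtain ⟨y, hy⟩ := hne
  refine isCompact_univ.measure_zero_of_nhdsWithin fun x _ => ?_
  obtain ⟨ρ, hρ⟩ := exists_sphereIsometry_apply_eq x y
  refine ⟨sphereIsometry ρ ⁻¹' U, ?_, ?_⟩
  · rw [nhdsWithin_univ]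
    exact (hU.preimage (sphereIsometry ρ).continuous).mem_nhds (by simpa [hρ] using hy)
  · rw [(hμ ρ).measure_preimage hU.measurableSet.nullMeasurableSet, hU0]

theorem sphereInvariant_hausdorffMeasure (d : ℝ) :
    SphereInvariant (μH[d] : Measure (sphere (0 : EuclideanSpace ℝ (Fin n)) 1)) :=
  fun ρ => (sphereIsometry ρ).measurePreserving_hausdorffMeasure d

theorem sphereInvariant_sphereMeasure : SphereInvariant (sphereMeasure n) :=
  fun ρ => (sphereInvariant_hausdorffMeasure _ ρ).smul_measure _

end Sphere

section Hausdorff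

/-- The graph parametrisation of the upper half of the unit sphere. -/
noncomputable def sphereGraph (m : ℕ) (y : Fin m → ℝ) : EuclideanSpace ℝ (Fin (m + 1)) :=
  WithLp.toLp 2 (Fin.snoc y √(1 - ∑ i, y i ^ 2) : Fin (m + 1) → ℝ)

theorem sphereGraph_mem_sphere {m : ℕ} {y : Fin m → ℝ} (hy : ∑ i, y i ^ 2 ≤ 1) :
    sphereGraph m y ∈ sphere (0 : EuclideanSpace ℝ (Fin (m + 1))) 1 := by
  rw [mem_sphere_zero_iff_norm, EuclideanSpace.norm_eq, Real.sqrt_eq_one, Fin.sum_univ_castSucc]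
  simp [sphereGraph, Real.sq_sqrt (sub_nonneg.2 hy)]

theorem sphereGraph_init {m : ℕ} (x : sphere (0 : EuclideanSpace ℝ (Fin (m + 1))) 1)
    (hx : 0 ≤ (x : EuclideanSpace ℝ (Fin (m + 1))) (Fin.last m)) :
    sphereGraph m (fun i => (x : EuclideanSpace ℝ (Fin (m + 1))) i.castSucc) = x := by
  have h := mem_sphere_zero_iff_norm.1 x.2
  rw [EuclideanSpace.norm_eq, Real.sqrt_eq_one, Fin.sum_univ_castSucc] at h
  simp only [Real.norm_eq_abs, sq_abs] at h
  ext j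
  refine Fin.lastCases ?_ (fun i => ?_) j
  · simp only [sphereGraph, Fin.snoc_last]
    rw [sub_eq_iff_eq_add'.2 h.symm, Real.sqrt_sq hx]
  · simp [sphereGraph]

theorem contDiffAt_sphereGraph (m : ℕ) : ContDiffAt ℝ 1 (sphereGraph m) 0 := by
  rw [contDiffAt_euclidean]
  intro j
  refine Fin.lastCases ?_ (fun i => ?_) j
  · simp only [sphereGraph, Fin.snoc_last]
    refine ContDiffAt.sqrt ?_ (by simp)
    fun_prop
  · simp only [sphereGraph, Fin.snoc_castSucc]
    fun_prop

theorem isFiniteMeasure_hausdorffMeasure_sphere (m : ℕ) :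
    IsFiniteMeasure (μH[(m : ℝ)] : Measure (sphere (0 : EuclideanSpace ℝ (Fin (m + 1))) 1)) := by
  have hpi : (μH[(m : ℝ)] : Measure (Fin m → ℝ)) = volume := by
    simpa using hausdorffMeasure_pi_real (ι := Fin m)
  obtain ⟨K, t, ht, hK⟩ := (contDiffAt_sphereGraph m).exists_lipschitzOnWith
  have ht' : t ∩ ball 0 1 ∈ nhds (0 : Fin m → ℝ) := inter_mem ht (ball_mem_nhds 0 one_pos)
  let U : Set (sphere (0 : EuclideanSpace ℝ (Fin (m + 1))) 1) :=
    (↑) ⁻¹' (sphereGraph m '' (t ∩ ball 0 1))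
  have hfin : μH[(m : ℝ)] U < ⊤ := by
    calc μH[(m : ℝ)] U = μH[(m : ℝ)] (Subtype.val '' U) :=
          (isometry_subtype_coe.hausdorffMeasure_image (Or.inl (by positivity)) _).symm
      _ ≤ μH[(m : ℝ)] (sphereGraph m '' (t ∩ ball 0 1)) :=
          measure_mono (Set.image_preimage_subset _ _)
      _ ≤ K ^ (m : ℝ) * μH[(m : ℝ)] (t ∩ ball 0 1) :=
          (hK.mono Set.inter_subset_left).hausdorffMeasure_image_le (by positivity)
      _ < ⊤ := by
          refine ENNReal.mul_lt_top (ENNReal.rpow_lt_top_of_nonneg (by positivity) (by simp)) ?_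
          rw [hpi]
          exact (measure_mono Set.inter_subset_right).trans_lt measure_ball_lt_top
  refine (sphereInvariant_hausdorffMeasure _).isFiniteMeasure (U := U) ?_ hfin
  let p : sphere (0 : EuclideanSpace ℝ (Fin (m + 1))) 1 :=
    ⟨sphereGraph m 0, sphereGraph_mem_sphere (by simp)⟩
  have hp1 : (p : EuclideanSpace ℝ (Fin (m + 1))) (Fin.last m) = 1 := by simp [p, sphereGraph]
  have hp0 : (fun i : Fin m => (p : EuclideanSpace ℝ (Fin (m + 1))) i.castSucc) = 0 := by
    ext i; simp [p, sphereGraph]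
  refine ⟨p, mem_interior_iff_mem_nhds.2 ?_⟩
  have hc : Continuous fun x : sphere (0 : EuclideanSpace ℝ (Fin (m + 1))) 1 =>
      (fun i : Fin m => (x : EuclideanSpace ℝ (Fin (m + 1))) i.castSucc) := by fun_prop
  have hc' : Continuous fun x : sphere (0 : EuclideanSpace ℝ (Fin (m + 1))) 1 =>
      (x : EuclideanSpace ℝ (Fin (m + 1))) (Fin.last m) := by fun_prop
  filter_upwards [hc.continuousAt.preimage_mem_nhds (by rw [hp0]; exact ht'),
    hc'.continuousAt.eventually (lt_mem_nhds (hp1.symm ▸ one_pos))] with x hx hx'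
  exact ⟨_, hx, sphereGraph_init x hx'.le⟩

theorem hausdorffMeasure_sphere_ne_zero (m : ℕ) :
    (μH[(m : ℝ)] : Measure (sphere (0 : EuclideanSpace ℝ (Fin (m + 1))) 1)) Set.univ ≠ 0 := by
  have hpi : (μH[(m : ℝ)] : Measure (Fin m → ℝ)) = volume := by
    simpa using hausdorffMeasure_pi_real (ι := Fin m)
  let π : sphere (0 : EuclideanSpace ℝ (Fin (m + 1))) 1 → (Fin m → ℝ) :=
    fun x i => (x : EuclideanSpace ℝ (Fin (m + 1))) i.castSucc
  have hπ : LipschitzWith 1 π := by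
    refine LipschitzWith.of_dist_le_mul fun x y => ?_
    rw [NNReal.coe_one, one_mul, dist_pi_le_iff dist_nonneg]
    intro i
    rw [Subtype.dist_eq, dist_eq_norm, dist_eq_norm]
    exact PiLp.norm_apply_le
      ((x : EuclideanSpace ℝ (Fin (m + 1))) - (y : EuclideanSpace ℝ (Fin (m + 1)))) i.castSucc
  have hopen : IsOpen {y : Fin m → ℝ | ∑ i, y i ^ 2 < 1} :=
    isOpen_lt (by fun_prop) continuous_const
  have hpos : 0 < (volume : Measure (Fin m → ℝ)) {y : Fin m → ℝ | ∑ i, y i ^ 2 < 1} :=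
    hopen.measure_pos _ ⟨0, by simp⟩
  have hsub : {y : Fin m → ℝ | ∑ i, y i ^ 2 < 1} ⊆ π '' Set.univ := by
    intro y hy
    refine ⟨⟨sphereGraph m y, sphereGraph_mem_sphere (le_of_lt hy)⟩, trivial, ?_⟩
    ext i
    simp [π, sphereGraph]
  intro h0
  have := hπ.hausdorffMeasure_image_le (d := (m : ℝ)) (by positivity) Set.univ
  rw [h0, mul_zero, hpi] at this
  exact absurd (hpos.trans_le ((measure_mono hsub).trans this)) (lt_irrefl _)

theorem isProbabilityMeasure_sphereMeasure {n : ℕ} (hn : 1 ≤ n) :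
    IsProbabilityMeasure (sphereMeasure n) := by
  obtain ⟨m, rfl⟩ := Nat.exists_eq_add_of_le' hn
  have hm : ((m + 1 : ℕ) : ℝ) - 1 = m := by push_cast; ring
  have := isFiniteMeasure_hausdorffMeasure_sphere m
  refine ⟨?_⟩
  rw [sphereMeasure, hm, Measure.smul_apply, smul_eq_mul]
  exact ENNReal.inv_mul_cancel (hausdorffMeasure_sphere_ne_zero m) (measure_ne_top _ _)

end Hausdorff

section Moments

variable {n : ℕ} {μ : Measure (sphere (0 : EuclideanSpace ℝ (Fin n)) 1)}

theorem integrable_sphere_of_continuous [IsFiniteMeasure μ] {f : EuclideanSpace ℝ (Fin n) → ℝ}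
    (hf : Continuous f) : Integrable (fun x : sphere (0 : EuclideanSpace ℝ (Fin n)) 1 => f x) μ :=
  (hf.comp continuous_subtype_val).integrable_of_hasCompactSupport
    (HasCompactSupport.of_compactSpace _)

theorem OrthonormalBasis.sum_inner_sq_eq_one
    (b : OrthonormalBasis (Fin n) ℝ (EuclideanSpace ℝ (Fin n)))
    (x : sphere (0 : EuclideanSpace ℝ (Fin n)) 1) :
    ∑ j, ⟪b j, (x : EuclideanSpace ℝ (Fin n))⟫ ^ 2 = 1 := by
  have := b.sum_sq_norm_inner_right (x : EuclideanSpace ℝ (Fin n))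
  simpa using this

/-- The integral of `f` over the spherical cap determined by `w` and `s`. -/
noncomputable def capIntegral (μ : Measure (sphere (0 : EuclideanSpace ℝ (Fin n)) 1)) (s : ℝ)
    (w : EuclideanSpace ℝ (Fin n)) (f : EuclideanSpace ℝ (Fin n) → ℝ) : ℝ :=
  ∫ x, {y | s ≤ ⟪w, y⟫}.indicator f (x : EuclideanSpace ℝ (Fin n)) ∂μ

theorem measurableSet_le_inner (s : ℝ) (w : EuclideanSpace ℝ (Fin n)) :
    MeasurableSet {y : EuclideanSpace ℝ (Fin n) | s ≤ ⟪w, y⟫} :=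
  (isClosed_le continuous_const (by fun_prop)).measurableSet

theorem integrable_indicator_cap [IsFiniteMeasure μ] (s : ℝ) (w : EuclideanSpace ℝ (Fin n))
    {f : EuclideanSpace ℝ (Fin n) → ℝ} (hf : Continuous f) :
    Integrable (fun x : sphere (0 : EuclideanSpace ℝ (Fin n)) 1 =>
      {y | s ≤ ⟪w, y⟫}.indicator f x) μ :=
  (integrable_sphere_of_continuous hf).indicator
    (measurable_subtype_coe (measurableSet_le_inner s w))

theorem SphereInvariant.capIntegral_comp (hμ : SphereInvariant μ) (s : ℝ)
    (w : EuclideanSpace ℝ (Fin n)) (f : EuclideanSpace ℝ (Fin n) → ℝ)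
    (ρ : EuclideanSpace ℝ (Fin n) ≃ₗᵢ[ℝ] EuclideanSpace ℝ (Fin n)) :
    capIntegral μ s w (fun y => f (ρ y)) = capIntegral μ s (ρ w) f := by
  unfold capIntegral
  rw [← hμ.integral_comp ρ ({y | s ≤ ⟪ρ w, y⟫}.indicator f)]
  congr 1
  ext x
  simp [Set.indicator_apply]

theorem capIntegral_add [IsFiniteMeasure μ] (s : ℝ) (w : EuclideanSpace ℝ (Fin n))
    {f g : EuclideanSpace ℝ (Fin n) → ℝ} (hf : Continuous f) (hg : Continuous g) :
    capIntegral μ s w (fun y => f y + g y) = capIntegral μ s w f + capIntegral μ s w g := by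
  unfold capIntegral
  rw [← integral_add (integrable_indicator_cap s w hf) (integrable_indicator_cap s w hg)]
  congr 1
  ext x
  simp only [Set.indicator_apply]
  split_ifs <;> simp

theorem capIntegral_const_mul (s c : ℝ) (w : EuclideanSpace ℝ (Fin n))
    (f : EuclideanSpace ℝ (Fin n) → ℝ) :
    capIntegral μ s w (fun y => c * f y) = c * capIntegral μ s w f := by
  unfold capIntegral
  rw [← integral_const_mul]
  congr 1
  ext x
  simp only [Set.indicator_apply]
  split_ifs <;> simp

theorem capIntegral_sum {ι : Type*} [IsFiniteMeasure μ] (s : ℝ) (w : EuclideanSpace ℝ (Fin n))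
    (F : Finset ι) {f : ι → EuclideanSpace ℝ (Fin n) → ℝ} (hf : ∀ i, Continuous (f i)) :
    capIntegral μ s w (fun y => ∑ i ∈ F, f i y) = ∑ i ∈ F, capIntegral μ s w (f i) := by
  unfold capIntegral
  rw [← integral_finsetSum _ fun i _ => integrable_indicator_cap s w (hf i)]
  congr 1
  ext x
  simp only [Set.indicator_apply]
  split_ifs <;> simp

theorem capIntegral_congr (s : ℝ) (w : EuclideanSpace ℝ (Fin n))
    {f g : EuclideanSpace ℝ (Fin n) → ℝ}
    (h : ∀ x : sphere (0 : EuclideanSpace ℝ (Fin n)) 1, f x = g x) :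
    capIntegral μ s w f = capIntegral μ s w g := by
  unfold capIntegral
  congr 1
  ext x
  simp [Set.indicator_apply, h]

/-- A cap integral of a function of two inner products does not change when the direction
orthogonal to the axis is replaced by another one of the same length. -/
theorem SphereInvariant.capIntegral_swap (hμ : SphereInvariant μ) (s : ℝ)
    {w p q : EuclideanSpace ℝ (Fin n)} (hp : ⟪w, p⟫ = 0) (hq : ⟪w, q⟫ = 0) (hpq : ‖p‖ = ‖q‖)
    (g : ℝ → ℝ → ℝ) :
    capIntegral μ s w (fun y => g ⟪w, y⟫ ⟪p, y⟫) = capIntegral μ s w (fun y => g ⟪w, y⟫ ⟪q, y⟫) := by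
  obtain ⟨ρ, h1, -, h3⟩ := exists_isometry_swap hpq
  have hw : ρ w = w := h3 w (by rw [hp, hq])
  have := hμ.capIntegral_comp s w (fun y => g ⟪w, y⟫ ⟪q, y⟫) ρ
  rw [hw] at this
  rw [← this]
  congr 1
  ext y
  rw [← h1, LinearIsometryEquiv.inner_map_map]
  conv_rhs => rw [← hw, LinearIsometryEquiv.inner_map_map]

theorem SphereInvariant.capIntegral_eq_zero_of_odd (hμ : SphereInvariant μ) (s : ℝ)
    {w p : EuclideanSpace ℝ (Fin n)} (hp : ⟪w, p⟫ = 0) (g : ℝ → ℝ → ℝ)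
    (hg : ∀ t r, g t (-r) = -g t r) :
    capIntegral μ s w (fun y => g ⟪w, y⟫ ⟪p, y⟫) = 0 := by
  have h := hμ.capIntegral_swap s hp (q := -p) (by simp [hp]) (by simp) g
  simp only [inner_neg_left, hg] at h
  have h' := capIntegral_const_mul (μ := μ) s (-1) w (fun y => g ⟪w, y⟫ ⟪p, y⟫)
  simp only [neg_one_mul] at h'
  linarith

theorem SphereInvariant.capIntegral_mul_inner_sq (hμ : SphereInvariant μ) (s : ℝ)
    {w p q : EuclideanSpace ℝ (Fin n)} (hp : ⟪w, p⟫ = 0) (hq : ⟪w, q⟫ = 0) (hq1 : ‖q‖ = 1) :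
    capIntegral μ s w (fun y => ⟪w, y⟫ * ⟪p, y⟫ ^ 2) =
      ‖p‖ ^ 2 * capIntegral μ s w (fun y => ⟪w, y⟫ * ⟪q, y⟫ ^ 2) := by
  rw [hμ.capIntegral_swap s hp (q := ‖p‖ • q) (by simp [inner_smul_right, hq])
    (by simp [norm_smul, hq1]) (fun t r => t * r ^ 2), ← capIntegral_const_mul]
  congr 1
  ext y
  rw [real_inner_smul_left]
  ring

/-- Relation between the first and third moments on a cap. -/
theorem SphereInvariant.capIntegral_inner [IsFiniteMeasure μ] (hμ : SphereInvariant μ) (s : ℝ)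
    (b : OrthonormalBasis (Fin n) ℝ (EuclideanSpace ℝ (Fin n))) (i : Fin n)
    {q : EuclideanSpace ℝ (Fin n)} (hq : ⟪b i, q⟫ = 0) (hq1 : ‖q‖ = 1) :
    capIntegral μ s (b i) (fun y => ⟪b i, y⟫) =
      capIntegral μ s (b i) (fun y => ⟪b i, y⟫ ^ 3) +
        ((n : ℝ) - 1) * capIntegral μ s (b i) (fun y => ⟪b i, y⟫ * ⟪q, y⟫ ^ 2) := by
  have h1 : capIntegral μ s (b i) (fun y => ⟪b i, y⟫) =
      ∑ j, capIntegral μ s (b i) (fun y => ⟪b i, y⟫ * ⟪b j, y⟫ ^ 2) := by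
    rw [← capIntegral_sum _ _ _ fun j => by fun_prop]
    refine capIntegral_congr _ _ fun x => ?_
    rw [← Finset.mul_sum, b.sum_inner_sq_eq_one, mul_one]
  rw [h1, ← Finset.add_sum_erase _ _ (Finset.mem_univ i)]
  have hn : 1 ≤ n := i.pos
  congr 1
  · congr 1; ext y; ring
  · rw [Finset.sum_congr rfl fun j hj => ?_, Finset.sum_const, Finset.card_erase_of_mem
      (Finset.mem_univ i), Finset.card_univ, Fintype.card_fin, nsmul_eq_mul, Nat.cast_sub hn,
      Nat.cast_one]
    rw [hμ.capIntegral_mul_inner_sq s (p := b j) ?_ hq hq1]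
    · simp
    · exact b.orthonormal.2 (Finset.ne_of_mem_erase hj).symm

/-- Cubes of linear forms integrate over a cap at a critical height as degree one quantities. -/
theorem SphereInvariant.capIntegral_inner_cube [IsFiniteMeasure μ] (hμ : SphereInvariant μ)
    (hn : 2 ≤ n) (s : ℝ) (b : OrthonormalBasis (Fin n) ℝ (EuclideanSpace ℝ (Fin n))) (i : Fin n)
    (hs : ((n : ℝ) + 2) * capIntegral μ s (b i) (fun y => ⟪b i, y⟫ ^ 3) =
      3 * capIntegral μ s (b i) (fun y => ⟪b i, y⟫)) (a : EuclideanSpace ℝ (Fin n)) :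
    capIntegral μ s (b i) (fun y => ⟪a, y⟫ ^ 3) =
      ⟪b i, a⟫ * ‖a‖ ^ 2 * capIntegral μ s (b i) (fun y => ⟪b i, y⟫ ^ 3) := by
  have : Nontrivial (Fin n) := Fin.nontrivial_iff_two_le.2 hn
  obtain ⟨j, hj⟩ := exists_ne i
  have hq : ⟪b i, b j⟫ = 0 := b.orthonormal.2 hj.symm
  have hq1 : ‖b j‖ = 1 := b.orthonormal.1 j
  have hT := hμ.capIntegral_inner s b i hq hq1
  obtain ⟨p, hp⟩ : ∃ p, p = a - ⟪b i, a⟫ • b i := ⟨_, rfl⟩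
  have hpi : ⟪b i, p⟫ = 0 := by
    rw [hp, inner_sub_right, inner_smul_right, real_inner_self_eq_norm_sq, b.orthonormal.1 i]
    ring
  have hpn : ‖p‖ ^ 2 = ‖a‖ ^ 2 - ⟪b i, a⟫ ^ 2 := by
    rw [hp, norm_sub_sq_real, inner_smul_right, norm_smul, b.orthonormal.1 i, real_inner_comm,
      mul_one, Real.norm_eq_abs, sq_abs]
    ring
  have hτ := hμ.capIntegral_mul_inner_sq s hpi hq hq1
  have hodd1 := hμ.capIntegral_eq_zero_of_odd s hpi (fun t r => t ^ 2 * r) (by intros; ring)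
  have hodd3 := hμ.capIntegral_eq_zero_of_odd s hpi (fun _ r => r ^ 3) (by intros; ring)
  have hexp : capIntegral μ s (b i) (fun y => ⟪a, y⟫ ^ 3) =
      ⟪b i, a⟫ ^ 3 * capIntegral μ s (b i) (fun y => ⟪b i, y⟫ ^ 3) +
      (3 * ⟪b i, a⟫ ^ 2 * capIntegral μ s (b i) (fun y => ⟪b i, y⟫ ^ 2 * ⟪p, y⟫) +
      (3 * ⟪b i, a⟫ * capIntegral μ s (b i) (fun y => ⟪b i, y⟫ * ⟪p, y⟫ ^ 2) +
        capIntegral μ s (b i) (fun y => ⟪p, y⟫ ^ 3))) := by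
    rw [← capIntegral_const_mul, ← capIntegral_const_mul, ← capIntegral_const_mul,
      ← capIntegral_add _ _ (by fun_prop) (by fun_prop),
      ← capIntegral_add _ _ (by fun_prop) (by fun_prop),
      ← capIntegral_add _ _ (by fun_prop) (by fun_prop)]
    congr 1
    ext y
    have : ⟪p, y⟫ = ⟪a, y⟫ - ⟪b i, a⟫ * ⟪b i, y⟫ := by
      rw [hp, inner_sub_left, real_inner_smul_left]
    rw [this]
    ring
  rw [hexp, hodd1, hodd3, hτ, hpn]
  have hn1 : ((n : ℝ) - 1) ≠ 0 := by
    have : (2 : ℝ) ≤ n := by exact_mod_cast hn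
    linarith
  apply mul_left_cancel₀ hn1
  linear_combination (-⟪b i, a⟫ * (‖a‖ ^ 2 - ⟪b i, a⟫ ^ 2)) * hs
    - 3 * ⟪b i, a⟫ * (‖a‖ ^ 2 - ⟪b i, a⟫ ^ 2) * hT

/-- The product of three orthogonal linear forms has vanishing integral over every cap of
critical height. -/
theorem SphereInvariant.capIntegral_mul_mul_eq_zero [IsFiniteMeasure μ] (hμ : SphereInvariant μ)
    (hn : 2 ≤ n) (s : ℝ) (b : OrthonormalBasis (Fin n) ℝ (EuclideanSpace ℝ (Fin n))) (i : Fin n)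
    (hs : ((n : ℝ) + 2) * capIntegral μ s (b i) (fun y => ⟪b i, y⟫ ^ 3) =
      3 * capIntegral μ s (b i) (fun y => ⟪b i, y⟫)) {v : Fin 3 → EuclideanSpace ℝ (Fin n)}
    (hv : Orthonormal ℝ v) :
    capIntegral μ s (b i) (fun y => ⟪v 0, y⟫ * ⟪v 1, y⟫ * ⟪v 2, y⟫) = 0 := by
  have hc := hμ.capIntegral_inner_cube hn s b i hs
  have h01 : ⟪v 0, v 1⟫ = 0 := hv.2 (by decide)
  have h02 : ⟪v 0, v 2⟫ = 0 := hv.2 (by decide)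
  have h12 : ⟪v 1, v 2⟫ = 0 := hv.2 (by decide)
  have hnorm : ∀ ε δ : ℝ, ε ^ 2 = 1 → δ ^ 2 = 1 → ‖v 0 + ε • v 1 + δ • v 2‖ ^ 2 = 3 := by
    intro ε δ hε hδ
    rw [norm_add_sq_real, norm_add_sq_real, inner_add_left, inner_smul_right, inner_smul_right,
      inner_smul_right, real_inner_smul_left, h01, h02, h12, norm_smul, norm_smul, hv.1, hv.1,
      hv.1, Real.norm_eq_abs, Real.norm_eq_abs, mul_one, mul_one, sq_abs, sq_abs, hε, hδ]
    norm_num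
  have hexp : 24 * capIntegral μ s (b i) (fun y => ⟪v 0, y⟫ * ⟪v 1, y⟫ * ⟪v 2, y⟫) =
      capIntegral μ s (b i) (fun y => ⟪v 0 + (1 : ℝ) • v 1 + (1 : ℝ) • v 2, y⟫ ^ 3) +
      ((-1) * capIntegral μ s (b i) (fun y => ⟪v 0 + (1 : ℝ) • v 1 + (-1 : ℝ) • v 2, y⟫ ^ 3) +
      ((-1) * capIntegral μ s (b i) (fun y => ⟪v 0 + (-1 : ℝ) • v 1 + (1 : ℝ) • v 2, y⟫ ^ 3) +
      capIntegral μ s (b i) (fun y => ⟪v 0 + (-1 : ℝ) • v 1 + (-1 : ℝ) • v 2, y⟫ ^ 3))) := by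
    rw [← capIntegral_const_mul, ← capIntegral_const_mul, ← capIntegral_const_mul,
      ← capIntegral_add _ _ (by fun_prop) (by fun_prop),
      ← capIntegral_add _ _ (by fun_prop) (by fun_prop),
      ← capIntegral_add _ _ (by fun_prop) (by fun_prop)]
    congr 1
    ext y
    simp only [inner_add_left, real_inner_smul_left]
    ring
  rw [hc (v 0 + (1 : ℝ) • v 1 + (1 : ℝ) • v 2), hc (v 0 + (1 : ℝ) • v 1 + (-1 : ℝ) • v 2),
    hc (v 0 + (-1 : ℝ) • v 1 + (1 : ℝ) • v 2), hc (v 0 + (-1 : ℝ) • v 1 + (-1 : ℝ) • v 2)] at hexp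
  rw [hnorm 1 1 (by norm_num) (by norm_num), hnorm 1 (-1) (by norm_num) (by norm_num),
    hnorm (-1) 1 (by norm_num) (by norm_num), hnorm (-1) (-1) (by norm_num) (by norm_num)] at hexp
  simp only [inner_add_right, inner_smul_right] at hexp
  linarith

end Moments

section CriticalHeight

variable {n : ℕ} {μ : Measure (sphere (0 : EuclideanSpace ℝ (Fin n)) 1)}

/-- Proper parallel sections of the sphere are null sets of an invariant finite measure. -/
theorem SphereInvariant.measure_inner_eq_zero [IsFiniteMeasure μ] (hμ : SphereInvariant μ)
    (hn : 2 ≤ n) {s : ℝ} (hs : 0 < s) {w : EuclideanSpace ℝ (Fin n)} (hw : ‖w‖ = 1) :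
    μ {x | ⟪w, (x : EuclideanSpace ℝ (Fin n))⟫ = s} = 0 := by
  have hrot : ∀ v : EuclideanSpace ℝ (Fin n), ‖v‖ = 1 →
      μ {x | ⟪v, (x : EuclideanSpace ℝ (Fin n))⟫ = s} =
        μ {x | ⟪w, (x : EuclideanSpace ℝ (Fin n))⟫ = s} := by
    intro v hv
    obtain ⟨ρ, h1, -, -⟩ := exists_isometry_swap (hv.trans hw.symm)
    have hm : MeasurableSet {x : sphere (0 : EuclideanSpace ℝ (Fin n)) 1 |
        ⟪w, (x : EuclideanSpace ℝ (Fin n))⟫ = s} :=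
      (isClosed_eq (by fun_prop) continuous_const).measurableSet
    rw [← (hμ ρ).measure_preimage hm.nullMeasurableSet]
    congr 1
    ext x
    simp only [Set.mem_ofPred_eq, Set.mem_preimage, coe_sphereIsometry]
    rw [← h1, LinearIsometryEquiv.inner_map_map]
  let b := EuclideanSpace.basisFun (Fin n) ℝ
  let i : Fin n := ⟨0, by omega⟩
  let j : Fin n := ⟨1, by omega⟩
  have hij : ⟪b i, b j⟫ = 0 := b.orthonormal.2 (by simp [i, j])
  let Z : Set (ℝ × sphere (0 : EuclideanSpace ℝ (Fin n)) 1) :=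
    {z | (1 - z.1 ^ 2) * ⟪b i, (z.2 : EuclideanSpace ℝ (Fin n))⟫ +
      2 * z.1 * ⟪b j, (z.2 : EuclideanSpace ℝ (Fin n))⟫ = s * (1 + z.1 ^ 2)}
  have hZ : MeasurableSet Z := (isClosed_eq (by fun_prop) (by fun_prop)).measurableSet
  have hfin : ∀ x : sphere (0 : EuclideanSpace ℝ (Fin n)) 1, {τ | (τ, x) ∈ Z}.Finite := by
    intro x
    let p : Polynomial ℝ :=
      Polynomial.C (s + ⟪b i, (x : EuclideanSpace ℝ (Fin n))⟫) * Polynomial.X ^ 2 +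
      Polynomial.C (-2 * ⟪b j, (x : EuclideanSpace ℝ (Fin n))⟫) * Polynomial.X +
      Polynomial.C (s - ⟪b i, (x : EuclideanSpace ℝ (Fin n))⟫)
    have hp : p ≠ 0 := by
      intro h
      have h0 : p.eval 0 = 0 := by rw [h]; simp
      have h1 : p.eval 1 = 0 := by rw [h]; simp
      have h2 : p.eval (-1) = 0 := by rw [h]; simp
      simp [p] at h0 h1 h2
      linarith
    refine (p.roots.toFinset.finite_toSet).subset fun τ hτ => ?_
    simp only [Finset.mem_coe, Multiset.mem_toFinset, Polynomial.mem_roots hp,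
      Polynomial.IsRoot.def]
    have hτ' : (1 - τ ^ 2) * ⟪b i, (x : EuclideanSpace ℝ (Fin n))⟫ +
      2 * τ * ⟪b j, (x : EuclideanSpace ℝ (Fin n))⟫ = s * (1 + τ ^ 2) := hτ
    simp only [p, Polynomial.eval_add, Polynomial.eval_mul, Polynomial.eval_C,
      Polynomial.eval_pow, Polynomial.eval_X]
    linarith
  have hnull : ((volume : Measure ℝ).prod μ) Z = 0 := by
    rw [Measure.prod_apply_symm hZ]
    simp only [lintegral_eq_zero_iff' (measurable_measure_prodMk_right hZ).aemeasurable]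
    exact Eventually.of_forall fun x => (hfin x).measure_zero _
  obtain ⟨τ, hτ⟩ := ((Measure.measure_prod_null hZ).1 hnull).exists
  have hpos : (0 : ℝ) < 1 + τ ^ 2 := by positivity
  let v : EuclideanSpace ℝ (Fin n) := (1 + τ ^ 2)⁻¹ • ((1 - τ ^ 2) • b i + (2 * τ) • b j)
  have hv : ‖v‖ = 1 := by
    have h : ‖(1 - τ ^ 2) • b i + (2 * τ) • b j‖ ^ 2 = (1 + τ ^ 2) ^ 2 := by
      rw [norm_add_sq_real, inner_smul_right, real_inner_smul_left, hij, norm_smul, norm_smul,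
        b.orthonormal.1, b.orthonormal.1, Real.norm_eq_abs, Real.norm_eq_abs, mul_one, mul_one,
        sq_abs, sq_abs]
      ring
    rw [norm_smul, (sq_eq_sq₀ (norm_nonneg _) hpos.le).1 h, Real.norm_of_nonneg (by positivity),
      inv_mul_cancel₀ hpos.ne']
  have hτ' : μ (Prod.mk τ ⁻¹' Z) = 0 := hτ
  rw [← hrot v hv, ← hτ']
  congr 1
  ext x
  simp only [Set.mem_ofPred_eq, Set.mem_preimage, v, Z, real_inner_smul_left, inner_add_left]
  rw [inv_mul_eq_iff_eq_mul₀ hpos.ne', mul_comm s]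

/-- Relation between the second and fourth moments of a linear form on the sphere. -/
theorem SphereInvariant.integral_inner_pow_four [IsFiniteMeasure μ] (hμ : SphereInvariant μ)
    (b : OrthonormalBasis (Fin n) ℝ (EuclideanSpace ℝ (Fin n))) (i : Fin n) :
    ((n : ℝ) + 2) * ∫ x, ⟪b i, (x : EuclideanSpace ℝ (Fin n))⟫ ^ 4 ∂μ =
      3 * ∫ x, ⟪b i, (x : EuclideanSpace ℝ (Fin n))⟫ ^ 2 ∂μ := by
  have hint : ∀ {f : EuclideanSpace ℝ (Fin n) → ℝ}, Continuous f →
      Integrable (fun x : sphere (0 : EuclideanSpace ℝ (Fin n)) 1 => f x) μ :=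
    fun hf => integrable_sphere_of_continuous hf
  have hpow : ∀ v : EuclideanSpace ℝ (Fin n), ∫ x, ⟪v, (x : EuclideanSpace ℝ (Fin n))⟫ ^ 4 ∂μ =
      ‖v‖ ^ 4 * ∫ x, ⟪b i, (x : EuclideanSpace ℝ (Fin n))⟫ ^ 4 ∂μ := by
    intro v
    obtain ⟨ρ, h1, -, -⟩ := exists_isometry_swap (a := v) (b := ‖v‖ • b i)
      (by simp [norm_smul, b.orthonormal.1 i])
    rw [← integral_const_mul, ← hμ.integral_comp ρ (fun y => ‖v‖ ^ 4 * ⟪b i, y⟫ ^ 4)]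
    congr 1
    ext x
    rw [← LinearIsometryEquiv.inner_map_map ρ v, h1, real_inner_smul_left]
    ring
  have hmix : ∀ j, j ≠ i → ∫ x, ⟪b i, (x : EuclideanSpace ℝ (Fin n))⟫ ^ 2 *
      ⟪b j, (x : EuclideanSpace ℝ (Fin n))⟫ ^ 2 ∂μ =
      (∫ x, ⟪b i, (x : EuclideanSpace ℝ (Fin n))⟫ ^ 4 ∂μ) / 3 := by
    intro j hj
    have hij : ⟪b i, b j⟫ = 0 := b.orthonormal.2 hj.symm
    have hadd : ‖b i + b j‖ ^ 2 = 2 := by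
      rw [norm_add_sq_real, hij, b.orthonormal.1, b.orthonormal.1]; norm_num
    have hsub : ‖b i - b j‖ ^ 2 = 2 := by
      rw [norm_sub_sq_real, hij, b.orthonormal.1, b.orthonormal.1]; norm_num
    have ha := hpow (b i + b j)
    have hs := hpow (b i - b j)
    have hj := hpow (b j)
    rw [b.orthonormal.1] at hj
    rw [show ‖b i + b j‖ ^ 4 = (‖b i + b j‖ ^ 2) ^ 2 by ring, hadd] at ha
    rw [show ‖b i - b j‖ ^ 4 = (‖b i - b j‖ ^ 2) ^ 2 by ring, hsub] at hs
    have hexp : ∫ x, ⟪b i + b j, (x : EuclideanSpace ℝ (Fin n))⟫ ^ 4 ∂μ +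
        ∫ x, ⟪b i - b j, (x : EuclideanSpace ℝ (Fin n))⟫ ^ 4 ∂μ =
        2 * ∫ x, ⟪b i, (x : EuclideanSpace ℝ (Fin n))⟫ ^ 4 ∂μ +
        12 * ∫ x, ⟪b i, (x : EuclideanSpace ℝ (Fin n))⟫ ^ 2 *
          ⟪b j, (x : EuclideanSpace ℝ (Fin n))⟫ ^ 2 ∂μ +
        2 * ∫ x, ⟪b j, (x : EuclideanSpace ℝ (Fin n))⟫ ^ 4 ∂μ := by
      rw [← integral_const_mul, ← integral_const_mul, ← integral_const_mul,
        ← integral_add (hint (f := fun y => ⟪b i + b j, y⟫ ^ 4) (by fun_prop))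
          (hint (f := fun y => ⟪b i - b j, y⟫ ^ 4) (by fun_prop)),
        ← integral_add (hint (f := fun y => 2 * ⟪b i, y⟫ ^ 4) (by fun_prop))
          (hint (f := fun y => 12 * (⟪b i, y⟫ ^ 2 * ⟪b j, y⟫ ^ 2)) (by fun_prop)),
        ← integral_add (hint (f := fun y => 2 * ⟪b i, y⟫ ^ 4 +
          12 * (⟪b i, y⟫ ^ 2 * ⟪b j, y⟫ ^ 2)) (by fun_prop))
          (hint (f := fun y => 2 * ⟪b j, y⟫ ^ 4) (by fun_prop))]
      congr 1
      ext x
      rw [inner_add_left, inner_sub_left]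
      ring
    linarith
  have hsum : ∫ x, ⟪b i, (x : EuclideanSpace ℝ (Fin n))⟫ ^ 2 ∂μ =
      ∑ j, ∫ x, ⟪b i, (x : EuclideanSpace ℝ (Fin n))⟫ ^ 2 *
        ⟪b j, (x : EuclideanSpace ℝ (Fin n))⟫ ^ 2 ∂μ := by
    rw [← integral_finsetSum _ fun j _ =>
      hint (f := fun y => ⟪b i, y⟫ ^ 2 * ⟪b j, y⟫ ^ 2) (by fun_prop)]
    congr 1
    ext x
    rw [← Finset.mul_sum, b.sum_inner_sq_eq_one, mul_one]
  have hn : 1 ≤ n := i.pos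
  rw [hsum, ← Finset.add_sum_erase _ _ (Finset.mem_univ i),
    Finset.sum_congr rfl fun j hj => hmix j (Finset.ne_of_mem_erase hj), Finset.sum_const,
    Finset.card_erase_of_mem (Finset.mem_univ i), Finset.card_univ, Fintype.card_fin,
    nsmul_eq_mul, Nat.cast_sub hn, Nat.cast_one]
  simp only [← pow_add]
  ring

theorem SphereInvariant.two_mul_capIntegral_zero [IsFiniteMeasure μ] (hμ : SphereInvariant μ)
    (w : EuclideanSpace ℝ (Fin n)) :
    2 * capIntegral μ 0 w (fun y => ((n : ℝ) + 2) * ⟪w, y⟫ ^ 3 - 3 * ⟪w, y⟫) =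
      ∫ x, |⟪w, (x : EuclideanSpace ℝ (Fin n))⟫| *
        (((n : ℝ) + 2) * ⟪w, (x : EuclideanSpace ℝ (Fin n))⟫ ^ 2 - 3) ∂μ := by
  have hneg := hμ.integral_comp (LinearIsometryEquiv.neg ℝ) ({y | 0 ≤ ⟪w, y⟫}.indicator
    (fun y => ((n : ℝ) + 2) * ⟪w, y⟫ ^ 3 - 3 * ⟪w, y⟫))
  have h1 := integrable_indicator_cap (μ := μ) 0 w
    (f := fun y => ((n : ℝ) + 2) * ⟪w, y⟫ ^ 3 - 3 * ⟪w, y⟫) (by fun_prop)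
  have h2 : Integrable (fun x : sphere (0 : EuclideanSpace ℝ (Fin n)) 1 =>
      {y | 0 ≤ ⟪w, y⟫}.indicator (fun y => ((n : ℝ) + 2) * ⟪w, y⟫ ^ 3 - 3 * ⟪w, y⟫)
        ((LinearIsometryEquiv.neg ℝ) (x : EuclideanSpace ℝ (Fin n)))) μ :=
    (hμ (LinearIsometryEquiv.neg ℝ)).integrable_comp_of_integrable h1
  rw [two_mul]
  unfold capIntegral
  nth_rewrite 1 [← hneg]
  rw [← integral_add h2 h1]
  congr 1
  ext x
  simp only [Set.indicator_apply, Set.mem_ofPred_eq, LinearIsometryEquiv.coe_neg, inner_neg_right]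
  rcases lt_trichotomy ⟪w, (x : EuclideanSpace ℝ (Fin n))⟫ 0 with h | h | h
  · rw [if_pos (by linarith), if_neg (by linarith), abs_of_neg h]
    ring
  · simp [h]
  · rw [if_neg (by linarith), if_pos h.le, abs_of_pos h]
    ring

theorem SphereInvariant.capIntegral_zero_neg [IsFiniteMeasure μ] [μ.IsOpenPosMeasure]
    (hμ : SphereInvariant μ) (hn : 2 ≤ n)
    (b : OrthonormalBasis (Fin n) ℝ (EuclideanSpace ℝ (Fin n))) (i : Fin n) :
    capIntegral μ 0 (b i) (fun y => ((n : ℝ) + 2) * ⟪b i, y⟫ ^ 3 - 3 * ⟪b i, y⟫) < 0 := by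
  obtain ⟨t, ht, ht2⟩ : ∃ t : ℝ, 0 < t ∧ ((n : ℝ) + 2) * t ^ 2 = 3 := by
    refine ⟨√(3 / (n + 2)), by positivity, ?_⟩
    rw [Real.sq_sqrt (by positivity)]
    field_simp
  have hint : ∀ {f : EuclideanSpace ℝ (Fin n) → ℝ}, Continuous f →
      Integrable (fun x : sphere (0 : EuclideanSpace ℝ (Fin n)) 1 => f x) μ :=
    fun hf => integrable_sphere_of_continuous hf
  let D : sphere (0 : EuclideanSpace ℝ (Fin n)) 1 → ℝ := fun x =>
    ((n : ℝ) + 2) * |⟪b i, (x : EuclideanSpace ℝ (Fin n))⟫| *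
      (|⟪b i, (x : EuclideanSpace ℝ (Fin n))⟫| - t) ^ 2 *
      (|⟪b i, (x : EuclideanSpace ℝ (Fin n))⟫| + t)
  have ht1 : t < 1 := by
    have : (2 : ℝ) ≤ n := by exact_mod_cast hn
    nlinarith
  have hD : 0 < ∫ x, D x ∂μ := by
    refine Continuous.integral_pos_of_hasCompactSupport_nonneg_nonzero (x := ⟨b i, by simp⟩)
      (by fun_prop) (HasCompactSupport.of_compactSpace _) (fun x => by positivity) ?_
    simp only [D, real_inner_self_eq_norm_sq, b.orthonormal.1 i]
    norm_num
    exact ⟨⟨by positivity, by linarith⟩, by linarith⟩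
  have hexp : ∫ x, D x ∂μ = ((n : ℝ) + 2) * ∫ x, ⟪b i, (x : EuclideanSpace ℝ (Fin n))⟫ ^ 4 ∂μ -
      3 * ∫ x, ⟪b i, (x : EuclideanSpace ℝ (Fin n))⟫ ^ 2 ∂μ -
      t * ∫ x, |⟪b i, (x : EuclideanSpace ℝ (Fin n))⟫| *
        (((n : ℝ) + 2) * ⟪b i, (x : EuclideanSpace ℝ (Fin n))⟫ ^ 2 - 3) ∂μ := by
    rw [← integral_const_mul, ← integral_const_mul, ← integral_const_mul,
      ← integral_sub (hint (f := fun y => ((n : ℝ) + 2) * ⟪b i, y⟫ ^ 4) (by fun_prop))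
        (hint (f := fun y => 3 * ⟪b i, y⟫ ^ 2) (by fun_prop)),
      ← integral_sub (hint (f := fun y => ((n : ℝ) + 2) * ⟪b i, y⟫ ^ 4 - 3 * ⟪b i, y⟫ ^ 2)
        (by fun_prop))
        (hint (f := fun y => t * (|⟪b i, y⟫| * (((n : ℝ) + 2) * ⟪b i, y⟫ ^ 2 - 3)))
          (by fun_prop))]
    congr 1
    ext x
    simp only [D]
    have h2 := sq_abs ⟪b i, (x : EuclideanSpace ℝ (Fin n))⟫
    rw [show ⟪b i, (x : EuclideanSpace ℝ (Fin n))⟫ ^ 4 =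
      (⟪b i, (x : EuclideanSpace ℝ (Fin n))⟫ ^ 2) ^ 2 by ring, ← h2]
    linear_combination (-|⟪b i, (x : EuclideanSpace ℝ (Fin n))⟫| ^ 2 +
      t * |⟪b i, (x : EuclideanSpace ℝ (Fin n))⟫|) * ht2
  rw [hμ.integral_inner_pow_four b i, sub_self, zero_sub,
    ← hμ.two_mul_capIntegral_zero (b i)] at hexp
  nlinarith

theorem SphereInvariant.continuousOn_capIntegral [IsFiniteMeasure μ] (hμ : SphereInvariant μ)
    (hn : 2 ≤ n) {w : EuclideanSpace ℝ (Fin n)} (hw : ‖w‖ = 1) {g : ℝ → ℝ} (hg : Continuous g)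
    (hg0 : g 0 = 0) :
    ContinuousOn (fun s => capIntegral μ s w (fun y => g ⟪w, y⟫)) (Set.Ici 0) := by
  intro s hs
  refine ContinuousAt.continuousWithinAt ?_
  refine continuousAt_of_dominated (bound := fun x => ‖g ⟪w, (x : EuclideanSpace ℝ (Fin n))⟫‖)
    (Eventually.of_forall fun r => ?_)
    (Eventually.of_forall fun r => Eventually.of_forall fun x => ?_)
    ?_ ?_
  · exact (integrable_indicator_cap r w (by fun_prop)).aestronglyMeasurable
  · exact norm_indicator_le_norm_self (fun y => g ⟪w, y⟫) _
  · exact integrable_sphere_of_continuous (f := fun y => ‖g ⟪w, y⟫‖) (by fun_prop)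
  · have hae : ∀ᵐ x : sphere (0 : EuclideanSpace ℝ (Fin n)) 1 ∂μ,
      ⟪w, (x : EuclideanSpace ℝ (Fin n))⟫ = s → s = 0 := by
      rcases (show (0 : ℝ) ≤ s from hs).eq_or_lt with h | h
      · exact Eventually.of_forall fun _ _ => h.symm
      · have := hμ.measure_inner_eq_zero hn h hw
        filter_upwards [measure_eq_zero_iff_ae_notMem.1 this] with x hx hx'
        exact absurd hx' hx
    filter_upwards [hae] with x hx
    simp only [Set.indicator_apply, Set.mem_ofPred_eq]
    rcases lt_trichotomy s ⟪w, (x : EuclideanSpace ℝ (Fin n))⟫ with h | h | h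
    · refine continuousAt_const.congr (f := fun _ => g ⟪w, (x : EuclideanSpace ℝ (Fin n))⟫) ?_
      filter_upwards [gt_mem_nhds h] with r hr
      rw [if_pos hr.le]
    · have h0 : g ⟪w, (x : EuclideanSpace ℝ (Fin n))⟫ = 0 := by rw [← h, hx h.symm, hg0]
      simp only [h0, ite_self]
      exact continuousAt_const
    · refine continuousAt_const.congr (f := fun _ => (0 : ℝ)) ?_
      filter_upwards [lt_mem_nhds h] with r hr
      rw [if_neg hr.not_ge]

/-- There is a height at which the degree three Funk–Hecke coefficient of the cap vanishes. -/
theorem SphereInvariant.exists_critical_height [IsFiniteMeasure μ] [μ.IsOpenPosMeasure]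
    (hμ : SphereInvariant μ) (hn : 2 ≤ n)
    (b : OrthonormalBasis (Fin n) ℝ (EuclideanSpace ℝ (Fin n))) (i : Fin n) :
    ∃ s ∈ Set.Ioo (0 : ℝ) 1, ((n : ℝ) + 2) * capIntegral μ s (b i) (fun y => ⟪b i, y⟫ ^ 3) =
      3 * capIntegral μ s (b i) (fun y => ⟪b i, y⟫) := by
  obtain ⟨t, ht, ht2⟩ : ∃ t : ℝ, 0 < t ∧ ((n : ℝ) + 2) * t ^ 2 = 3 := by
    refine ⟨√(3 / (n + 2)), by positivity, ?_⟩
    rw [Real.sq_sqrt (by positivity)]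
    field_simp
  have ht1 : t < 1 := by
    have : (2 : ℝ) ≤ n := by exact_mod_cast hn
    nlinarith
  have hneg := hμ.capIntegral_zero_neg hn b i
  have hpos : 0 ≤ capIntegral μ t (b i) (fun y => ((n : ℝ) + 2) * ⟪b i, y⟫ ^ 3 - 3 * ⟪b i, y⟫) := by
    refine integral_nonneg fun x => Set.indicator_nonneg (fun y hy => ?_) _
    have hy' : t ≤ ⟪b i, y⟫ := hy
    have h3 : 3 ≤ ((n : ℝ) + 2) * ⟪b i, y⟫ ^ 2 := by rw [← ht2]; gcongr
    nlinarith
  have hcont := hμ.continuousOn_capIntegral hn (b.orthonormal.1 i)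
    (g := fun r => ((n : ℝ) + 2) * r ^ 3 - 3 * r) (by fun_prop) (by simp)
  obtain ⟨s, hs, hs0⟩ := intermediate_value_Icc ht.le (hcont.mono Set.Icc_subset_Ici_self)
    ⟨hneg.le, hpos⟩
  simp only at hs0
  have hs' : 0 < s := hs.1.lt_of_ne (by rintro rfl; exact hneg.ne hs0)
  refine ⟨s, ⟨hs', hs.2.trans_lt ht1⟩, ?_⟩
  have hsplit := capIntegral_add (μ := μ) s (b i) (f := fun y => ((n : ℝ) + 2) * ⟪b i, y⟫ ^ 3)
    (g := fun y => (-3) * ⟪b i, y⟫) (by fun_prop) (by fun_prop)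
  rw [capIntegral_const_mul, capIntegral_const_mul] at hsplit
  have heq : capIntegral μ s (b i) (fun y => ((n : ℝ) + 2) * ⟪b i, y⟫ ^ 3 - 3 * ⟪b i, y⟫) =
      capIntegral μ s (b i) (fun y => ((n : ℝ) + 2) * ⟪b i, y⟫ ^ 3 + (-3) * ⟪b i, y⟫) := by
    congr 1; ext y; ring
  linarith

end CriticalHeight

section Density

variable {X : Type*} [MeasurableSpace X] {μ : Measure X} {h : X → ℝ}

theorem measureReal_withDensity_one_add [IsFiniteMeasure μ] (hi : Integrable h μ)
    (hb : ∀ x, -1 ≤ h x) {A : Set X} (hA : MeasurableSet A) :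
    (μ.withDensity fun x => ENNReal.ofReal (1 + h x)).real A = μ.real A + ∫ x in A, h x ∂μ := by
  have hnonneg : ∀ x, 0 ≤ 1 + h x := fun x => by linarith [hb x]
  have hi' : Integrable (fun x => 1 + h x) (μ.restrict A) :=
    ((integrable_const 1).add hi).integrableOn
  rw [measureReal_def, withDensity_apply _ hA,
    ← ofReal_integral_eq_lintegral_ofReal hi' (Eventually.of_forall hnonneg),
    ENNReal.toReal_ofReal (integral_nonneg hnonneg),
    integral_add (integrable_const 1) hi.integrableOn]
  simp

theorem isProbabilityMeasure_withDensity_one_add [IsProbabilityMeasure μ] (hi : Integrable h μ)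
    (hb : ∀ x, -1 ≤ h x) (h0 : ∫ x, h x ∂μ = 0) :
    IsProbabilityMeasure (μ.withDensity fun x => ENNReal.ofReal (1 + h x)) := by
  have := measureReal_withDensity_one_add hi hb MeasurableSet.univ
  rw [setIntegral_univ, h0, probReal_univ (μ := μ), add_zero, measureReal_def] at this
  exact ⟨(ENNReal.toReal_eq_one_iff _).1 this⟩

theorem exists_mem_Ioo_measure_level_eq_zero [IsFiniteMeasure μ] (hm : Measurable h) {a b : ℝ}
    (hab : a < b) : ∃ r ∈ Set.Ioo a b, μ {x | h x = r} = 0 := by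
  have hc : {r : ℝ | 0 < μ {x | h x = r}}.Countable := Measure.countable_meas_level_set_pos hm
  obtain ⟨r, hr, hr'⟩ := Set.not_subset.1 fun hs =>
    Cardinal.Real.Ioo_countable_iff.not.2 hab.not_ge (hc.mono hs)
  exact ⟨r, hr, nonpos_iff_eq_zero.1 (not_lt.1 hr')⟩

end Density

section TripleProduct

variable {n : ℕ} {μ : Measure (sphere (0 : EuclideanSpace ℝ (Fin n)) 1)}
  {v : Fin 3 → EuclideanSpace ℝ (Fin n)}

theorem neg_one_le_mul_inner (hv : Orthonormal ℝ v)
    (x : sphere (0 : EuclideanSpace ℝ (Fin n)) 1) :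
    -1 ≤ ⟪v 0, (x : EuclideanSpace ℝ (Fin n))⟫ * ⟪v 1, (x : EuclideanSpace ℝ (Fin n))⟫ *
      ⟪v 2, (x : EuclideanSpace ℝ (Fin n))⟫ := by
  have hle : ∀ i, |⟪v i, (x : EuclideanSpace ℝ (Fin n))⟫| ≤ 1 := fun i =>
    (abs_real_inner_le_norm _ _).trans (by simp [hv.1 i])
  refine (abs_le.1 ?_).1
  rw [abs_mul, abs_mul]
  exact mul_le_one₀ (mul_le_one₀ (hle 0) (abs_nonneg _) (hle 1)) (abs_nonneg _) (hle 2)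

theorem SphereInvariant.integral_mul_inner_eq_zero (hμ : SphereInvariant μ)
    (hv : Orthonormal ℝ v) :
    ∫ x, ⟪v 0, (x : EuclideanSpace ℝ (Fin n))⟫ * ⟪v 1, (x : EuclideanSpace ℝ (Fin n))⟫ *
      ⟪v 2, (x : EuclideanSpace ℝ (Fin n))⟫ ∂μ = 0 := by
  obtain ⟨ρ, h1, -, h2⟩ := exists_isometry_swap (norm_neg (v 0)).symm
  have hfix : ∀ i, i ≠ 0 → ρ (v i) = v i := fun i hi => h2 _ (by
    rw [inner_neg_right, hv.2 hi, neg_zero])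
  have h := hμ.integral_comp ρ (fun y => ⟪v 0, y⟫ * ⟪v 1, y⟫ * ⟪v 2, y⟫)
  have hneg : ∀ y, ⟪v 0, ρ y⟫ = -⟪v 0, y⟫ := fun y => by
    rw [← inner_neg_left, ← ρ.inner_map_map (-v 0), map_neg, h1, neg_neg]
  have hsame : ∀ i, i ≠ 0 → ∀ y, ⟪v i, ρ y⟫ = ⟪v i, y⟫ := fun i hi y => by
    conv_lhs => rw [← hfix i hi, ρ.inner_map_map]
  simp only [hneg, hsame 1 (by decide), hsame 2 (by decide), neg_mul, integral_neg] at h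
  linarith

theorem SphereInvariant.capIntegral_mul_mul_eq_zero_of_norm_eq_one [IsFiniteMeasure μ]
    (hμ : SphereInvariant μ) (hn : 2 ≤ n) (s : ℝ)
    (b : OrthonormalBasis (Fin n) ℝ (EuclideanSpace ℝ (Fin n))) (i : Fin n)
    (hs : ((n : ℝ) + 2) * capIntegral μ s (b i) (fun y => ⟪b i, y⟫ ^ 3) =
      3 * capIntegral μ s (b i) (fun y => ⟪b i, y⟫)) (hv : Orthonormal ℝ v)
    {w : EuclideanSpace ℝ (Fin n)} (hw : ‖w‖ = 1) :
    capIntegral μ s w (fun y => ⟪v 0, y⟫ * ⟪v 1, y⟫ * ⟪v 2, y⟫) = 0 := by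
  obtain ⟨ρ, rfl, -, -⟩ := exists_isometry_swap ((b.orthonormal.1 i).trans hw.symm)
  have h1 := hμ.capIntegral_comp s (b i) (fun y => ⟪ρ (b i), y⟫) ρ
  have h3 := hμ.capIntegral_comp s (b i) (fun y => ⟪ρ (b i), y⟫ ^ 3) ρ
  simp only [ρ.inner_map_map] at h1 h3
  simpa using hμ.capIntegral_mul_mul_eq_zero hn s (b.map ρ) i
    (by simpa [← h1, ← h3] using hs) hv

theorem exists_sphere_lt_mul_inner (hv : Orthonormal ℝ v) :
    ∃ x : sphere (0 : EuclideanSpace ℝ (Fin n)) 1, 1 / 8 <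
      ⟪v 0, (x : EuclideanSpace ℝ (Fin n))⟫ * ⟪v 1, (x : EuclideanSpace ℝ (Fin n))⟫ *
        ⟪v 2, (x : EuclideanSpace ℝ (Fin n))⟫ := by
  have h3 : (0 : ℝ) < √3 := by positivity
  have hsq : √(3 : ℝ) ^ 2 = 3 := Real.sq_sqrt (by norm_num)
  have hin : ∀ i, ⟪v i, (√3)⁻¹ • ∑ j, v j⟫ = (√3)⁻¹ := fun i => by
    rw [inner_smul_right, inner_sum, Finset.sum_eq_single i (fun j _ hj => hv.2 hj.symm) (by simp),
      real_inner_self_eq_norm_sq, hv.1]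
    simp
  have hnorm : ‖(√3)⁻¹ • ∑ j, v j‖ = 1 := by
    rw [← sq_eq_sq₀ (norm_nonneg _) zero_le_one, ← real_inner_self_eq_norm_sq,
      real_inner_smul_left, sum_inner, Finset.sum_congr rfl fun i _ => hin i]
    simp
    field_simp
    linarith
  refine ⟨⟨_, by simpa using hnorm⟩, ?_⟩
  simp only [hin]
  have h2 : √(3 : ℝ) < 2 := by nlinarith
  have : (1 / 2 : ℝ) < (√3)⁻¹ := by rw [one_div]; gcongr
  calc (1 / 8 : ℝ) = 1 / 2 * (1 / 2) * (1 / 2) := by norm_num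
    _ < _ := by gcongr

end TripleProduct

theorem stmt2 (n : ℕ) (hn : 3 ≤ n) :
    ∃ s ∈ Set.Ioo (0 : ℝ) 1,
      ∃ u : ℕ → sphere (0 : EuclideanSpace ℝ (Fin n)) 1,
        (∀ w : sphere (0 : EuclideanSpace ℝ (Fin n)) 1,
          Tendsto (fun N => freq u (cap n s w) N) atTop
            (nhds ((sphereMeasure n) (cap n s w)).toReal)) ∧
        ∃ A : Set (sphere (0 : EuclideanSpace ℝ (Fin n)) 1), MeasurableSet A ∧
          (sphereMeasure n) (frontier A) = 0 ∧
          ¬ Tendsto (fun N => freq u A N) atTop (nhds ((sphereMeasure n) A).toReal) := by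
  have hμ := sphereInvariant_sphereMeasure (n := n)
  have hprob := isProbabilityMeasure_sphereMeasure (n := n) (by omega)
  have hpos := hμ.isOpenPosMeasure (by simp)
  have hn2 : 2 ≤ n := by omega
  let b := EuclideanSpace.basisFun (Fin n) ℝ
  let v : Fin 3 → EuclideanSpace ℝ (Fin n) := fun k => b (Fin.castLE hn k)
  have hv : Orthonormal ℝ v := b.orthonormal.comp _ (Fin.castLE_injective hn)
  obtain ⟨s, hs, hcrit⟩ := hμ.exists_critical_height hn2 b ⟨0, by omega⟩
  let H : EuclideanSpace ℝ (Fin n) → ℝ := fun y => ⟪v 0, y⟫ * ⟪v 1, y⟫ * ⟪v 2, y⟫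
  have hH : Continuous H := by fun_prop
  let h : sphere (0 : EuclideanSpace ℝ (Fin n)) 1 → ℝ := fun x => H x
  have hh : Continuous h := hH.comp continuous_subtype_val
  have hi : Integrable h (sphereMeasure n) := integrable_sphere_of_continuous hH
  have hb : ∀ x, -1 ≤ h x := neg_one_le_mul_inner hv
  have hν := isProbabilityMeasure_withDensity_one_add hi hb (hμ.integral_mul_inner_eq_zero hv)
  set ν := (sphereMeasure n).withDensity fun x => ENNReal.ofReal (1 + h x)
  have hac : ν ≪ sphereMeasure n := withDensity_absolutelyContinuous _ _
  obtain ⟨u, hu⟩ := exists_seq_tendsto_freq_of_null_frontier ν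
  refine ⟨s, hs, u, fun w => ?_, ?_⟩
  · have hclosed : IsClosed (cap n s w) := isClosed_le continuous_const (by fun_prop)
    have hfr : sphereMeasure n (frontier (cap n s w)) = 0 := by
      refine measure_mono_null (frontier_le_subset_eq continuous_const (by fun_prop)) ?_
      simpa only [eq_comm] using hμ.measure_inner_eq_zero hn2 hs.1 (mem_sphere_zero_iff_norm.1 w.2)
    have hcap := hμ.capIntegral_mul_mul_eq_zero_of_norm_eq_one hn2 s b _ hcrit hv
      (mem_sphere_zero_iff_norm.1 w.2)
    have hcap' : ∫ x in cap n s w, h x ∂sphereMeasure n = 0 := by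
      rw [← integral_indicator hclosed.measurableSet]
      exact hcap
    have := hu _ (hac hfr)
    rwa [measureReal_withDensity_one_add hi hb hclosed.measurableSet, hcap', add_zero] at this
  · obtain ⟨r, ⟨hr0, hr⟩, hlevel⟩ := exists_mem_Ioo_measure_level_eq_zero (μ := sphereMeasure n)
      hh.measurable (show (0 : ℝ) < 1 / 8 by norm_num)
    have hopen : IsOpen {x | r < h x} := isOpen_lt continuous_const hh
    have hfr : sphereMeasure n (frontier {x | r < h x}) = 0 := by
      refine measure_mono_null (frontier_lt_subset_eq continuous_const hh) ?_
      simpa only [eq_comm] using hlevel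
    refine ⟨{x | r < h x}, hopen.measurableSet, hfr, fun hlim => ?_⟩
    have heq := tendsto_nhds_unique hlim (hu _ (hac hfr))
    rw [measureReal_withDensity_one_add hi hb hopen.measurableSet] at heq
    have hA : 0 < (sphereMeasure n).real {x | r < h x} := by
      obtain ⟨x, hx⟩ := exists_sphere_lt_mul_inner hv
      exact ENNReal.toReal_pos (hopen.measure_pos _ ⟨x, hr.trans hx⟩).ne' (measure_ne_top _ _)
    have hint : r * (sphereMeasure n).real {x | r < h x} ≤
        ∫ x in {x | r < h x}, h x ∂sphereMeasure n :=
      setIntegral_ge_of_const_le_real hopen.measurableSet (measure_ne_top _ _)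
        (fun x hx => le_of_lt hx) hi.integrableOn
    rw [measureReal_def] at heq hA hint
    nlinarith
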